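/- There is a universal constant c > 0 such that for every integer ℓ ≥ 1, every three times differentiable f : ℝ^d → ℝ, and every x ∈ ℝ^d, with A := ∇³f_x: ( E_{p ~ N(0, I_d)} | A[p,p,p] |^ℓ )^{1/ℓ} ≤ c ( ℓ^{3/2} ‖A‖_{{1,2,3}} + ℓ^{1/2} d^{1/2} ‖A‖_{{1,2}{3}} ), where A[p,p,p] = Σ_{i,j,k} A_{ijk} p_i p_j p_k. In particular, if f is γL^{3/2}-strongly Hessian Lipschitz the bound is O(γ ℓ^{3/2} L^{3/2} d^{1/2}). -/

import Mathlib

open MeasureTheory Real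
open scoped ENNReal NNReal

noncomputable section

/-- The Euclidean space `ℝ^d`. -/
abbrev Euc (d : ℕ) := EuclideanSpace ℝ (Fin d)

/-- `leapfrog f η k (q₀,p₀)` is the `k`-th leapfrog iterate with step size `η` for the
potential `f`, starting at `(q₀,p₀)`. -/
def leapfrog {d : ℕ} (f : Euc d → ℝ) (η : ℝ) : ℕ → Euc d × Euc d → Euc d × Euc d
  | 0, z => z
  | (k+1), z =>
      let w := leapfrog f η k z
      let q' := w.1 + η • w.2 - (η^2/2) • gradient f w.1
      (q', w.2 - (η/2) • gradient f w.1 - (η/2) • gradient f q')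

/-- `f` is `L`-smooth: the Hessian has operator norm at most `L` everywhere. -/
def LSmooth {d : ℕ} (f : Euc d → ℝ) (L : ℝ) : Prop :=
  ∀ x, ‖fderiv ℝ (gradient f) x‖ ≤ L

/-- The entries of the third-derivative tensor of `f` at `x`. -/
def tensor3 {ι : Type*} [Fintype ι] [DecidableEq ι]
    (f : EuclideanSpace ℝ ι → ℝ) (x : EuclideanSpace ℝ ι) (i j k : ι) : ℝ :=
  iteratedFDeriv ℝ 3 f x
    ![EuclideanSpace.single i 1, EuclideanSpace.single j 1, EuclideanSpace.single k 1]

/-- The `{1,2,3}`-norm (Frobenius norm) of a 3-tensor. -/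
def norm123 {ι : Type*} [Fintype ι] (A : ι → ι → ι → ℝ) : ℝ :=
  Real.sqrt (∑ i, ∑ j, ∑ k, (A i j k)^2)

/-- The `{1,2}{3}`-norm of a 3-tensor. -/
def norm12_3 {ι : Type*} [Fintype ι] (A : ι → ι → ι → ℝ) : ℝ :=
  sSup { s | ∃ (X : ι → ι → ℝ) (y : ι → ℝ), (∑ i, ∑ j, (X i j)^2) ≤ 1 ∧
    (∑ k, (y k)^2) ≤ 1 ∧ s = ∑ i, ∑ j, ∑ k, A i j k * X i j * y k }

/-- `f` is `γ L^{3/2}`-strongly Hessian Lipschitz. -/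
def StronglyHessLip {d : ℕ} (f : Euc d → ℝ) (γ L : ℝ) : Prop :=
  ∀ x, norm12_3 (tensor3 f x) ≤ γ * L ^ ((3:ℝ)/2)

/-- Distance between two sets. -/
def setDistance {α : Type*} [PseudoMetricSpace α] (S T : Set α) : ℝ :=
  sInf { r | ∃ x ∈ S, ∃ y ∈ T, r = dist x y }

/-- Cheeger isoperimetric inequality with coefficient `ψ`. -/
def CheegerIso {d : ℕ} (μ : Measure (Euc d)) (ψ : ℝ) : Prop :=
  ∀ S1 S2 S3 : Set (Euc d), MeasurableSet S1 → MeasurableSet S2 → MeasurableSet S3 →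
    Disjoint S1 S2 → Disjoint S1 S3 → Disjoint S2 S3 → S1 ∪ S2 ∪ S3 = Set.univ →
    ψ * setDistance S1 S2 * (μ S1).toReal * (μ S2).toReal ≤ (μ S3).toReal

/-- The probability measure proportional to `e^{-f}`. -/
def targetMeasure {d : ℕ} (f : Euc d → ℝ) : Measure (Euc d) :=
  ((volume.withDensity fun x => ENNReal.ofReal (Real.exp (-f x))) Set.univ)⁻¹ •
    (volume.withDensity fun x => ENNReal.ofReal (Real.exp (-f x)))

/-- The standard Gaussian measure `N(0, I_d)` on `ℝ^d`. -/
def stdGaussian (d : ℕ) : Measure (Euc d) :=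
  Measure.map (⇑(EuclideanSpace.equiv (Fin d) ℝ).symm)
    (Measure.pi fun _ : Fin d => ProbabilityTheory.gaussianReal 0 1)

/-- Metropolis acceptance probability of the HMC proposal. -/
def accProb {d : ℕ} (f : Euc d → ℝ) (K : ℕ) (η : ℝ) (q p : Euc d) : ℝ :=
  min 1 (Real.exp (-(f (leapfrog f η K (q,p)).1) - ‖(leapfrog f η K (q,p)).2‖^2/2
    + f q + ‖p‖^2/2))

/-- One step of Metropolized HMC with `K` leapfrog steps and step size `η`, from `q`. -/
def hmcKernel {d : ℕ} (f : Euc d → ℝ) (K : ℕ) (η : ℝ) (q : Euc d) : Measure (Euc d) :=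
  (stdGaussian d).bind fun p =>
    ENNReal.ofReal (accProb f K η q p) • Measure.dirac (leapfrog f η K (q,p)).1 +
    ENNReal.ofReal (1 - accProb f K η q p) • Measure.dirac q

/-- One step of the lazy version of Metropolized HMC. -/
def lazyHMC {d : ℕ} (f : Euc d → ℝ) (K : ℕ) (η : ℝ) (q : Euc d) : Measure (Euc d) :=
  (2:ℝ≥0∞)⁻¹ • Measure.dirac q + (2:ℝ≥0∞)⁻¹ • hmcKernel f K η q

/-- The law of the lazy Metropolized HMC chain after `n` steps started from `μ₀`. -/
def hmcIter {d : ℕ} (f : Euc d → ℝ) (K : ℕ) (η : ℝ) (μ0 : Measure (Euc d)) :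
    ℕ → Measure (Euc d)
  | 0 => μ0
  | (n+1) => (hmcIter f K η μ0 n).bind (lazyHMC f K η)

/-- Total variation distance between two measures. -/
def tvDist {α : Type*} [MeasurableSpace α] (P Q : Measure α) : ℝ :=
  sSup { r | ∃ A, MeasurableSet A ∧ r = |(P A).toReal - (Q A).toReal| }

/-- `ε`-mixing time of lazy Metropolized HMC started from `μ₀`, targetting `μ ∝ e^{-f}`. -/
def mixingTime {d : ℕ} (f : Euc d → ℝ) (K : ℕ) (η : ℝ) (μ0 : Measure (Euc d)) (ε : ℝ) : ℕ :=
  sInf { n : ℕ | tvDist (hmcIter f K η μ0 n) (targetMeasure f) ≤ ε }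

/-- `μ₀` is `M`-warm with respect to `μ`. -/
def Warm {α : Type*} [MeasurableSpace α] (μ0 μ : Measure α) (M : ℝ) : Prop :=
  ∀ S : Set α, MeasurableSet S → μ0 S ≤ ENNReal.ofReal M * μ S

/-- `e^{-f}` has subexponential tail. -/
def SubexpTail {d : ℕ} (f : Euc d → ℝ) : Prop :=
  ∃ lam > (0:ℝ), Filter.Tendsto (fun x : Euc d => Real.exp (lam * ‖x‖) * Real.exp (-f x))
    (Bornology.cobounded _) (nhds 0)

end

/-! ### Moments of Gaussian linear forms -/

lemma eLpNorm_natCast_pow {Ω : Type*} [MeasurableSpace Ω] (ν : Measure Ω) (f : Ω → ℝ) {n : ℕ}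
    (hn : n ≠ 0) : eLpNorm f n ν ^ n = ∫⁻ x, ‖f x‖ₑ ^ n ∂ν := by
  rw [eLpNorm_eq_lintegral_rpow_enorm_toReal (by simpa using hn) (by simp)]
  simp only [ENNReal.toReal_natCast, one_div, ENNReal.rpow_natCast]
  rw [← ENNReal.rpow_natCast, ENNReal.rpow_inv_rpow (by positivity)]

lemma eLpNorm_natCast_le_iff {Ω : Type*} [MeasurableSpace Ω] {ν : Measure Ω} {f : Ω → ℝ} {n : ℕ}
    (hn : n ≠ 0) {C : ℝ≥0∞} :
    eLpNorm f n ν ≤ C ↔ ∫⁻ x, ‖f x‖ₑ ^ n ∂ν ≤ C ^ n := by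
  rw [← eLpNorm_natCast_pow ν f hn, ENNReal.pow_le_pow_left_iff hn]

lemma ofReal_mul_sqrt_pow_two_mul {a b : ℝ} (ha : 0 ≤ a) (hb : 0 ≤ b) (m : ℕ) :
    ENNReal.ofReal (a * √b) ^ (2 * m) = ENNReal.ofReal a ^ (2 * m) * ENNReal.ofReal b ^ m := by
  rw [ENNReal.ofReal_mul ha, mul_pow, pow_mul (ENNReal.ofReal (√b)),
    ← ENNReal.ofReal_pow (Real.sqrt_nonneg b), Real.sq_sqrt hb]

lemma pow_two_mul_le_factorial_mul_cosh (y : ℝ) (m : ℕ) :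
    y ^ (2 * m) ≤ (2 * m).factorial * Real.cosh y := by
  have h := le_hasSum (Real.hasSum_cosh y) m fun n _ => by rw [pow_mul]; positivity
  rwa [div_le_iff₀' (by positivity)] at h

lemma eLpNorm_id_gaussianReal_le {m : ℕ} (hm : m ≠ 0) :
    eLpNorm (fun y : ℝ => y) (2 * m : ℕ) (ProbabilityTheory.gaussianReal 0 1)
      ≤ ENNReal.ofReal (3 * √m) := by
  rw [eLpNorm_natCast_le_iff (by positivity), ← ENNReal.ofReal_pow (by positivity)]
  have hm0 : (0 : ℝ) < m := by positivity
  set t : ℝ := √(2 * m) with ht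
  have ht2 : t ^ 2 = 2 * m := Real.sq_sqrt (by positivity)
  have ht0 : 0 < t := by positivity
  let g (y : ℝ) : ℝ :=
    (2 * m).factorial / t ^ (2 * m) / 2 * (Real.exp (t * y) + Real.exp (-t * y))
  have hint (s : ℝ) : Integrable (fun y => Real.exp (s * y))
      (ProbabilityTheory.gaussianReal 0 1) :=
    ProbabilityTheory.integrable_exp_mul_gaussianReal s
  have hmgf (s : ℝ) : ∫ y, Real.exp (s * y) ∂(ProbabilityTheory.gaussianReal 0 1)
      = Real.exp (s ^ 2 / 2) := by
    have := congrFun (ProbabilityTheory.mgf_id_gaussianReal (μ := 0) (v := 1)) s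
    simpa [ProbabilityTheory.mgf] using this
  have hle (y : ℝ) : ‖y‖ₑ ^ (2 * m) ≤ ENNReal.ofReal (g y) := by
    rw [← ofReal_norm, ← ENNReal.ofReal_pow (norm_nonneg _)]
    refine ENNReal.ofReal_le_ofReal ?_
    have h := pow_two_mul_le_factorial_mul_cosh (t * y) m
    rw [Real.norm_eq_abs, pow_mul, sq_abs, ← pow_mul]
    rw [mul_pow, Real.cosh_eq] at h
    calc y ^ (2 * m) = t ^ (2 * m) * y ^ (2 * m) / t ^ (2 * m) := by field_simp
      _ ≤ (2 * m).factorial * ((Real.exp (t * y) + Real.exp (-(t * y))) / 2) / t ^ (2 * m) := by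
          gcongr
      _ = g y := by simp only [g, neg_mul]; ring
  calc ∫⁻ y, ‖y‖ₑ ^ (2 * m) ∂(ProbabilityTheory.gaussianReal 0 1)
      ≤ ∫⁻ y, ENNReal.ofReal (g y) ∂(ProbabilityTheory.gaussianReal 0 1) := lintegral_mono hle
    _ = ENNReal.ofReal (∫ y, g y ∂(ProbabilityTheory.gaussianReal 0 1)) := by
        refine (ofReal_integral_eq_lintegral_ofReal (((hint t).add (hint (-t))).const_mul _)
          (Filter.Eventually.of_forall fun y => ?_)).symm
        exact mul_nonneg (by positivity) (add_nonneg (Real.exp_nonneg _) (Real.exp_nonneg _))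
    _ ≤ _ := by
        refine ENNReal.ofReal_le_ofReal ?_
        rw [integral_const_mul, integral_add (hint t) (hint (-t)), hmgf, hmgf, neg_sq, ht2]
        have hfac : ((2 * m).factorial : ℝ) ≤ (2 * m) ^ (2 * m) := by
          exact_mod_cast Nat.factorial_le_pow (2 * m)
        have hexp : Real.exp m ≤ (9 / 2) ^ m := by
          rw [← Real.exp_one_pow]
          gcongr
          linarith [Real.exp_one_lt_d9]
        have htm : t ^ (2 * m) = (2 * m) ^ m := by rw [pow_mul, ht2]
        rw [htm, mul_pow 3, pow_mul (√_), Real.sq_sqrt hm0.le, mul_div_cancel_left₀ _ two_ne_zero]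
        calc ((2 * m).factorial : ℝ) / (2 * m) ^ m / 2 * (Real.exp m + Real.exp m)
            = ((2 * m).factorial : ℝ) / (2 * m) ^ m * Real.exp m := by ring
          _ ≤ (2 * m) ^ (2 * m) / (2 * m) ^ m * (9 / 2) ^ m := by gcongr
          _ = 3 ^ (2 * m) * (m : ℝ) ^ m := by
              rw [two_mul m, pow_add, mul_div_cancel_right₀ _ (by positivity), ← mul_pow,
                ← two_mul, pow_mul, ← mul_pow]
              congr 1
              ring

lemma eLpNorm_sum_mul_stdGaussian_le {ι : Type*} [Fintype ι] {m : ℕ} (hm : m ≠ 0) (a : ι → ℝ) :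
    eLpNorm (fun y : EuclideanSpace ℝ ι => ∑ k, a k * y k) (2 * m : ℕ)
        (ProbabilityTheory.stdGaussian (EuclideanSpace ℝ ι))
      ≤ ENNReal.ofReal (3 * √m * √(∑ k, a k ^ 2)) := by
  let v : EuclideanSpace ℝ ι := WithLp.toLp 2 a
  have hv : ‖v‖ = √(∑ k, a k ^ 2) := by simp [EuclideanSpace.norm_eq, v]
  have hL : (fun y : EuclideanSpace ℝ ι => ∑ k, a k * y k) = innerSL ℝ v := by
    ext y
    simp [PiLp.inner_apply, v, mul_comm]
  have hmap : (ProbabilityTheory.stdGaussian (EuclideanSpace ℝ ι)).map (innerSL ℝ v)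
      = (ProbabilityTheory.gaussianReal 0 1).map (‖v‖ * ·) := by
    rw [ProbabilityTheory.IsGaussian.map_eq_gaussianReal,
      ProbabilityTheory.integral_strongDual_stdGaussian,
      ProbabilityTheory.variance_dual_stdGaussian, ProbabilityTheory.gaussianReal_map_const_mul]
    congr 1
    · simp
    · ext
      simp
  calc eLpNorm (fun y : EuclideanSpace ℝ ι => ∑ k, a k * y k) (2 * m : ℕ)
        (ProbabilityTheory.stdGaussian (EuclideanSpace ℝ ι))
      = eLpNorm (fun y : ℝ => y) (2 * m : ℕ)
          ((ProbabilityTheory.stdGaussian (EuclideanSpace ℝ ι)).map (innerSL ℝ v)) := by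
        rw [eLpNorm_map_measure (by fun_prop) (by fun_prop), hL]
        rfl
    _ = eLpNorm (‖v‖ • fun y : ℝ => y) (2 * m : ℕ) (ProbabilityTheory.gaussianReal 0 1) := by
        rw [hmap, eLpNorm_map_measure (by fun_prop) (by fun_prop)]
        rfl
    _ ≤ ENNReal.ofReal ‖v‖ * ENNReal.ofReal (3 * √m) := by
        rw [eLpNorm_const_smul, enorm_norm, ofReal_norm]
        gcongr
        exact eLpNorm_id_gaussianReal_le hm
    _ = _ := by rw [← ENNReal.ofReal_mul (norm_nonneg _), hv, mul_comm]

lemma eLpNorm_sum_mul_prod_stdGaussian_le {ι Ω : Type*} [Fintype ι] [MeasurableSpace Ω]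
    {ν : Measure Ω} [SFinite ν] {m : ℕ} (hm : m ≠ 0) {g : ι → Ω → ℝ} (hg : ∀ k, Measurable (g k))
    {C : ι → ℝ} (hC : ∀ k, 0 ≤ C k)
    (hgC : ∀ k, eLpNorm (g k) (2 * m : ℕ) ν ≤ ENNReal.ofReal (C k)) :
    eLpNorm (fun z : Ω × EuclideanSpace ℝ ι => ∑ k, g k z.1 * z.2 k) (2 * m : ℕ)
        (ν.prod (ProbabilityTheory.stdGaussian (EuclideanSpace ℝ ι)))
      ≤ ENNReal.ofReal (3 * √m * √(∑ k, C k ^ 2)) := by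
  have hsq (k : ι) : eLpNorm (fun ω => g k ω ^ 2) m ν ≤ ENNReal.ofReal (C k ^ 2) := by
    rw [eLpNorm_natCast_le_iff hm]
    have h := (eLpNorm_natCast_le_iff (by positivity)).1 (hgC k)
    simpa only [enorm_pow, ← pow_mul, ENNReal.ofReal_pow (hC k)] using h
  have hsum : eLpNorm (fun ω => ∑ k, g k ω ^ 2) m ν ≤ ENNReal.ofReal (∑ k, C k ^ 2) := by
    have h := eLpNorm_sum_le (s := Finset.univ) (f := fun k ω => g k ω ^ 2) (μ := ν) (p := m)
      (fun k _ => ((hg k).pow_const 2).aestronglyMeasurable)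
      (by exact_mod_cast Nat.one_le_iff_ne_zero.2 hm)
    rw [ENNReal.ofReal_sum_of_nonneg fun k _ => sq_nonneg _]
    refine le_trans (le_of_eq ?_) (h.trans (Finset.sum_le_sum fun k _ => hsq k))
    congr 1
    ext ω
    simp
  rw [eLpNorm_natCast_le_iff hm] at hsum
  rw [eLpNorm_natCast_le_iff (by positivity), lintegral_prod _ (by fun_prop)]
  calc ∫⁻ ω, ∫⁻ y, ‖∑ k, g k ω * y k‖ₑ ^ (2 * m)
          ∂(ProbabilityTheory.stdGaussian (EuclideanSpace ℝ ι)) ∂ν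
      ≤ ∫⁻ ω, ENNReal.ofReal (3 * √m) ^ (2 * m) * ‖∑ k, g k ω ^ 2‖ₑ ^ m ∂ν := by
        refine lintegral_mono fun ω => ?_
        refine ((eLpNorm_natCast_le_iff (by positivity)).1
          (eLpNorm_sum_mul_stdGaussian_le hm fun k => g k ω)).trans (le_of_eq ?_)
        have h0 : 0 ≤ ∑ k, g k ω ^ 2 := by positivity
        rw [ofReal_mul_sqrt_pow_two_mul (by positivity) h0, Real.enorm_of_nonneg h0]
    _ = ENNReal.ofReal (3 * √m) ^ (2 * m) * ∫⁻ ω, ‖∑ k, g k ω ^ 2‖ₑ ^ m ∂ν :=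
        lintegral_const_mul _ (by fun_prop)
    _ ≤ ENNReal.ofReal (3 * √m) ^ (2 * m) * ENNReal.ofReal (∑ k, C k ^ 2) ^ m := by gcongr
    _ = _ := (ofReal_mul_sqrt_pow_two_mul (by positivity) (by positivity) m).symm

/-! ### Bilinear and quadratic forms -/

lemma eLpNorm_bilinear_stdGaussian_le {ι : Type*} [Fintype ι] {m : ℕ} (hm : m ≠ 0)
    (B : ι → ι → ℝ) :
    eLpNorm (fun z : EuclideanSpace ℝ ι × EuclideanSpace ℝ ι =>
        ∑ i, ∑ j, B i j * z.1 i * z.2 j) (2 * m : ℕ)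
        ((ProbabilityTheory.stdGaussian (EuclideanSpace ℝ ι)).prod
          (ProbabilityTheory.stdGaussian (EuclideanSpace ℝ ι)))
      ≤ ENNReal.ofReal (9 * m * √(∑ i, ∑ j, B i j ^ 2)) := by
  have h := eLpNorm_sum_mul_prod_stdGaussian_le hm
    (ν := ProbabilityTheory.stdGaussian (EuclideanSpace ℝ ι))
    (g := fun j x => ∑ i, B i j * x i) (by fun_prop)
    (C := fun j => 3 * √m * √(∑ i, B i j ^ 2)) (fun j => by positivity)
    fun j => eLpNorm_sum_mul_stdGaussian_le hm fun i => B i j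
  have hsq (j : ι) : (3 * √m * √(∑ i, B i j ^ 2)) ^ 2 = (3 * √m) ^ 2 * ∑ i, B i j ^ 2 := by
    rw [mul_pow _ (√_), Real.sq_sqrt (by positivity)]
  simp only [hsq, ← Finset.mul_sum, Finset.sum_mul] at h
  rw [Real.sqrt_mul (by positivity), Real.sqrt_sq (by positivity), ← mul_assoc] at h
  have h9 : 3 * √m * (3 * √m) = 9 * (m : ℝ) := by
    nlinarith [Real.mul_self_sqrt (Nat.cast_nonneg (α := ℝ) m)]
  rw [h9, Finset.sum_comm] at h
  refine le_trans (le_of_eq ?_) h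
  congr 1
  ext z
  exact Finset.sum_comm

lemma eLpNorm_sub_integral_le {Ω : Type*} [MeasurableSpace Ω] {ν : Measure Ω}
    [IsProbabilityMeasure ν] {f : Ω → ℝ} (hf : Measurable f) (hint : Integrable f ν) {n : ℕ}
    (hn : n ≠ 0) :
    eLpNorm (fun x => f x - ∫ y, f y ∂ν) n ν
      ≤ eLpNorm (fun z : Ω × Ω => f z.1 - f z.2) n (ν.prod ν) := by
  rw [eLpNorm_natCast_le_iff hn, eLpNorm_natCast_pow _ _ hn, lintegral_prod _ (by fun_prop)]
  refine lintegral_mono fun x => ?_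
  calc ‖f x - ∫ y, f y ∂ν‖ₑ ^ n = ‖∫ y, (f x - f y) ∂ν‖ₑ ^ n := by
        rw [integral_sub (integrable_const _) hint]
        simp
    _ ≤ (eLpNorm (fun y => f x - f y) 1 ν) ^ n := by
        rw [eLpNorm_one_eq_lintegral_enorm]
        gcongr
        exact enorm_integral_le_lintegral_enorm _
    _ ≤ (eLpNorm (fun y => f x - f y) n ν) ^ n := by
        gcongr
        exact eLpNorm_le_eLpNorm_of_exponent_le
          (by exact_mod_cast Nat.one_le_iff_ne_zero.2 hn) (by fun_prop)
    _ = _ := eLpNorm_natCast_pow ν _ hn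

lemma memLp_stdGaussian_of_abs_le {ι : Type*} [Fintype ι] {f : EuclideanSpace ℝ ι → ℝ}
    (hf : Measurable f) {C : ℝ} {n : ℕ} (hn : n ≠ 0) (hfC : ∀ x, |f x| ≤ C * ‖x‖ ^ n) {p : ℝ≥0∞}
    (hp : p ≠ ∞) : MemLp f p (ProbabilityTheory.stdGaussian (EuclideanSpace ℝ ι)) := by
  have h := (ProbabilityTheory.IsGaussian.memLp_id
    (ProbabilityTheory.stdGaussian (EuclideanSpace ℝ ι)) (p * n)
      (ENNReal.mul_ne_top hp (by simp))).norm_rpow_div n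
  rw [ENNReal.mul_div_cancel_right (by simpa using hn) (by simp)] at h
  simp only [id_eq, ENNReal.toReal_natCast, Real.rpow_natCast] at h
  refine (h.const_mul C).mono hf.aestronglyMeasurable (Filter.Eventually.of_forall fun x => ?_)
  exact (hfC x).trans (le_abs_self _)

lemma integral_apply_mul_apply_stdGaussian {ι : Type*} [Fintype ι] [DecidableEq ι] (i j : ι) :
    ∫ x, x i * x j ∂(ProbabilityTheory.stdGaussian (EuclideanSpace ℝ ι))
      = if i = j then 1 else 0 := by
  have h := ProbabilityTheory.covarianceBilin_apply
    (μ := ProbabilityTheory.stdGaussian (EuclideanSpace ℝ ι))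
    ProbabilityTheory.IsGaussian.memLp_two_id (EuclideanSpace.basisFun ι ℝ i)
    (EuclideanSpace.basisFun ι ℝ j)
  rw [ProbabilityTheory.covarianceBilin_stdGaussian, innerSL_apply_apply] at h
  simpa [EuclideanSpace.inner_single_left, PiLp.single_apply, eq_comm] using h.symm

lemma memLp_quadratic_stdGaussian {ι : Type*} [Fintype ι] (B : ι → ι → ℝ) {p : ℝ≥0∞}
    (hp : p ≠ ∞) :
    MemLp (fun x : EuclideanSpace ℝ ι => ∑ i, ∑ j, B i j * x i * x j) p
      (ProbabilityTheory.stdGaussian (EuclideanSpace ℝ ι)) := by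
  refine memLp_finsetSum _ fun i _ => memLp_finsetSum _ fun j _ =>
    memLp_stdGaussian_of_abs_le (by fun_prop) (C := |B i j|) two_ne_zero (fun x => ?_) hp
  rw [abs_mul, abs_mul, mul_assoc, sq]
  gcongr <;> exact PiLp.norm_apply_le x _

lemma memLp_cubic_stdGaussian {ι : Type*} [Fintype ι] (A : ι → ι → ι → ℝ) {p : ℝ≥0∞}
    (hp : p ≠ ∞) :
    MemLp (fun x : EuclideanSpace ℝ ι => ∑ i, ∑ j, ∑ k, A i j k * x i * x j * x k) p
      (ProbabilityTheory.stdGaussian (EuclideanSpace ℝ ι)) := by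
  refine memLp_finsetSum _ fun i _ => memLp_finsetSum _ fun j _ => memLp_finsetSum _ fun k _ =>
    memLp_stdGaussian_of_abs_le (by fun_prop) (C := |A i j k|) three_ne_zero (fun x => ?_) hp
  rw [abs_mul, abs_mul, abs_mul, show |A i j k| * ‖x‖ ^ 3 = |A i j k| * ‖x‖ * ‖x‖ * ‖x‖ by ring]
  gcongr <;> exact PiLp.norm_apply_le x _

lemma integral_quadratic_stdGaussian {ι : Type*} [Fintype ι] (B : ι → ι → ℝ) :
    ∫ x : EuclideanSpace ℝ ι, ∑ i, ∑ j, B i j * x i * x j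
      ∂(ProbabilityTheory.stdGaussian (EuclideanSpace ℝ ι)) = ∑ i, B i i := by
  classical
  have hint (i j : ι) : Integrable (fun x : EuclideanSpace ℝ ι => B i j * x i * x j)
      (ProbabilityTheory.stdGaussian (EuclideanSpace ℝ ι)) := by
    refine memLp_one_iff_integrable.1 (memLp_stdGaussian_of_abs_le (by fun_prop)
      (C := |B i j|) two_ne_zero (fun x => ?_) ENNReal.one_ne_top)
    rw [abs_mul, abs_mul, mul_assoc, sq]
    gcongr <;> exact PiLp.norm_apply_le x _
  rw [integral_finsetSum _ fun i _ => integrable_finsetSum _ fun j _ => hint i j]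
  refine Finset.sum_congr rfl fun i _ => ?_
  rw [integral_finsetSum _ fun j _ => hint i j]
  simp [mul_assoc, integral_const_mul, integral_apply_mul_apply_stdGaussian]

lemma measurePreserving_rotation_stdGaussian (ι : Type*) [Fintype ι] :
    MeasurePreserving (fun z : EuclideanSpace ℝ ι × EuclideanSpace ℝ ι =>
        ((√2)⁻¹ • (z.1 + z.2), (√2)⁻¹ • (z.2 - z.1)))
      ((ProbabilityTheory.stdGaussian (EuclideanSpace ℝ ι)).prod
        (ProbabilityTheory.stdGaussian (EuclideanSpace ℝ ι)))
      ((ProbabilityTheory.stdGaussian (EuclideanSpace ℝ ι)).prod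
        (ProbabilityTheory.stdGaussian (EuclideanSpace ℝ ι))) := by
  refine ⟨by fun_prop, ?_⟩
  have h := ProbabilityTheory.IsGaussian.map_rotation_eq_self
    (μ := ProbabilityTheory.stdGaussian (EuclideanSpace ℝ ι)) (by simp) (π / 4)
  have hs : √2 / 2 = (√2)⁻¹ := by
    rw [div_eq_iff two_ne_zero, inv_mul_eq_div, Real.div_sqrt]
  convert h using 2
  ext z : 1
  rw [ContinuousLinearMap.rotation_apply, Real.cos_pi_div_four, Real.sin_pi_div_four, hs,
    smul_add, smul_sub, neg_smul, sub_eq_neg_add]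

lemma eLpNorm_quadratic_stdGaussian_le {ι : Type*} [Fintype ι] {m : ℕ} (hm : m ≠ 0)
    {B : ι → ι → ℝ} (hB : ∀ i j, B i j = B j i) :
    eLpNorm (fun x : EuclideanSpace ℝ ι => ∑ i, ∑ j, B i j * x i * x j) (2 * m : ℕ)
        (ProbabilityTheory.stdGaussian (EuclideanSpace ℝ ι))
      ≤ ENNReal.ofReal (|∑ i, B i i| + 18 * m * √(∑ i, ∑ j, B i j ^ 2)) := by
  set μ := ProbabilityTheory.stdGaussian (EuclideanSpace ℝ ι)
  set q : EuclideanSpace ℝ ι → ℝ := fun x => ∑ i, ∑ j, B i j * x i * x j with hq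
  have hqm : Measurable q := by fun_prop
  have hp1 : (1 : ℝ≥0∞) ≤ (2 * m : ℕ) := by
    exact_mod_cast Nat.one_le_iff_ne_zero.2 (by positivity)
  have hcross (z : EuclideanSpace ℝ ι × EuclideanSpace ℝ ι) :
      q ((√2)⁻¹ • (z.1 + z.2)) - q ((√2)⁻¹ • (z.2 - z.1))
        = 2 * ∑ i, ∑ j, B i j * z.1 i * z.2 j := by
    have hs : (√2)⁻¹ * (√2)⁻¹ = (2 : ℝ)⁻¹ := by
      rw [← mul_inv, Real.mul_self_sqrt zero_le_two]
    have hterm (i j : ι) :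
        B i j * ((√2)⁻¹ * (z.1 i + z.2 i)) * ((√2)⁻¹ * (z.1 j + z.2 j))
          - B i j * ((√2)⁻¹ * (z.2 i - z.1 i)) * ((√2)⁻¹ * (z.2 j - z.1 j))
          = B i j * z.1 i * z.2 j + B j i * z.1 j * z.2 i := by
      rw [hB j i]
      linear_combination (2 * B i j * (z.1 i * z.2 j + z.1 j * z.2 i)) * hs
    simp only [hq, PiLp.smul_apply, PiLp.add_apply, PiLp.sub_apply, smul_eq_mul,
      ← Finset.sum_sub_distrib, hterm, Finset.sum_add_distrib]
    rw [two_mul, Finset.sum_comm (f := fun i j => B j i * z.1 j * z.2 i)]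
  have hdec : eLpNorm (fun x => q x - ∑ i, B i i) (2 * m : ℕ) μ
      ≤ ENNReal.ofReal (18 * m * √(∑ i, ∑ j, B i j ^ 2)) := by
    rw [← integral_quadratic_stdGaussian B]
    refine (eLpNorm_sub_integral_le hqm (memLp_one_iff_integrable.1
      (memLp_quadratic_stdGaussian B ENNReal.one_ne_top)) (by positivity)).trans ?_
    rw [← eLpNorm_comp_measurePreserving (by fun_prop) (measurePreserving_rotation_stdGaussian ι)]
    have heq : (fun z : EuclideanSpace ℝ ι × EuclideanSpace ℝ ι => q z.1 - q z.2) ∘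
        (fun z : EuclideanSpace ℝ ι × EuclideanSpace ℝ ι =>
          ((√2)⁻¹ • (z.1 + z.2), (√2)⁻¹ • (z.2 - z.1)))
          = (2 : ℝ) • fun z : EuclideanSpace ℝ ι × EuclideanSpace ℝ ι =>
            ∑ i, ∑ j, B i j * z.1 i * z.2 j := by
      ext z
      exact hcross z
    rw [heq, eLpNorm_const_smul, Real.enorm_of_nonneg zero_le_two]
    refine (mul_le_mul_right (eLpNorm_bilinear_stdGaussian_le hm B) _).trans (le_of_eq ?_)
    rw [← ENNReal.ofReal_mul zero_le_two]
    congr 1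
    ring
  calc eLpNorm q (2 * m : ℕ) μ
      = eLpNorm ((fun _ => ∑ i, B i i) + fun x => q x - ∑ i, B i i) (2 * m : ℕ) μ := by
        congr 1
        ext x
        simp
    _ ≤ eLpNorm (fun _ : EuclideanSpace ℝ ι => ∑ i, B i i) (2 * m : ℕ) μ
        + eLpNorm (fun x => q x - ∑ i, B i i) (2 * m : ℕ) μ :=
        eLpNorm_add_le (by fun_prop) (by fun_prop) hp1
    _ ≤ ENNReal.ofReal |∑ i, B i i| + ENNReal.ofReal (18 * m * √(∑ i, ∑ j, B i j ^ 2)) := by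
        refine add_le_add (le_of_eq ?_) hdec
        rw [eLpNorm_const' _ (zero_lt_one.trans_le hp1).ne' (ENNReal.natCast_ne_top _), measure_univ,
          ENNReal.one_rpow, mul_one, Real.enorm_eq_ofReal_abs]
    _ = _ := (ENNReal.ofReal_add (abs_nonneg _) (by positivity)).symm

/-! ### Cubic forms -/

lemma eLpNorm_quadratic_linear_stdGaussian_le {ι : Type*} [Fintype ι] {m : ℕ} (hm : m ≠ 0)
    {A : ι → ι → ι → ℝ} (hA : ∀ i j k, A i j k = A j i k) :
    eLpNorm (fun z : EuclideanSpace ℝ ι × EuclideanSpace ℝ ι =>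
        ∑ i, ∑ j, ∑ k, A i j k * z.1 i * z.1 j * z.2 k) (2 * m : ℕ)
        ((ProbabilityTheory.stdGaussian (EuclideanSpace ℝ ι)).prod
          (ProbabilityTheory.stdGaussian (EuclideanSpace ℝ ι)))
      ≤ ENNReal.ofReal (3 * √m * (2 * √(∑ k, (∑ i, A i i k) ^ 2) + 36 * m * norm123 A)) := by
  have h := eLpNorm_sum_mul_prod_stdGaussian_le hm
    (ν := ProbabilityTheory.stdGaussian (EuclideanSpace ℝ ι))
    (g := fun k x => ∑ i, ∑ j, A i j k * x i * x j)
    (C := fun k => |∑ i, A i i k| + 18 * m * √(∑ i, ∑ j, A i j k ^ 2))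
    (fun k => by fun_prop) (fun k => by positivity)
    (fun k => eLpNorm_quadratic_stdGaussian_le hm fun i j => hA i j k)
  have heq (z : EuclideanSpace ℝ ι × EuclideanSpace ℝ ι) :
      ∑ k, (∑ i, ∑ j, A i j k * z.1 i * z.1 j) * z.2 k
        = ∑ i, ∑ j, ∑ k, A i j k * z.1 i * z.1 j * z.2 k := by
    simp only [Finset.sum_mul]
    rw [Finset.sum_comm]
    exact Finset.sum_congr rfl fun i _ => Finset.sum_comm
  simp only [heq] at h
  refine h.trans (ENNReal.ofReal_le_ofReal ?_)
  have hF : norm123 A ^ 2 = ∑ k, √(∑ i, ∑ j, A i j k ^ 2) ^ 2 := by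
    rw [norm123, Real.sq_sqrt (by positivity), eq_comm]
    simp_rw [Real.sq_sqrt (Finset.sum_nonneg fun i _ => Finset.sum_nonneg fun j _ =>
      sq_nonneg (A i j _))]
    rw [Finset.sum_comm]
    exact Finset.sum_congr rfl fun i _ => Finset.sum_comm
  have hF0 : 0 ≤ norm123 A := Real.sqrt_nonneg _
  gcongr
  refine Real.sqrt_le_iff.2 ⟨by positivity, ?_⟩
  set b := √(∑ k, (∑ i, A i i k) ^ 2)
  have hb : b ^ 2 = ∑ k, (∑ i, A i i k) ^ 2 := Real.sq_sqrt (by positivity)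
  calc ∑ k, (|∑ i, A i i k| + 18 * m * √(∑ i, ∑ j, A i j k ^ 2)) ^ 2
      ≤ ∑ k, (2 * (∑ i, A i i k) ^ 2 + 2 * (18 * m) ^ 2 * √(∑ i, ∑ j, A i j k ^ 2) ^ 2) := by
        refine Finset.sum_le_sum fun k _ => ?_
        have := add_sq_le (a := |∑ i, A i i k|) (b := 18 * m * √(∑ i, ∑ j, A i j k ^ 2))
        rw [sq_abs] at this
        linarith
    _ = 2 * b ^ 2 + 2 * (18 * m) ^ 2 * norm123 A ^ 2 := by
        rw [Finset.sum_add_distrib, ← Finset.mul_sum, ← Finset.mul_sum, hb, hF]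
    _ ≤ (2 * b + 36 * m * norm123 A) ^ 2 := by
        have : 0 ≤ b * (m * norm123 A) := by positivity
        nlinarith [sq_nonneg b, sq_nonneg (m * norm123 A)]

lemma eLpNorm_cubic_stdGaussian_le {ι : Type*} [Fintype ι] {m : ℕ} (hm : m ≠ 0)
    {A : ι → ι → ι → ℝ} (hA : ∀ i j k, A i j k = A j i k) (hA' : ∀ i j k, A i j k = A i k j) :
    eLpNorm (fun x : EuclideanSpace ℝ ι => ∑ i, ∑ j, ∑ k, A i j k * x i * x j * x k) (2 * m : ℕ)
        (ProbabilityTheory.stdGaussian (EuclideanSpace ℝ ι))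
      ≤ ENNReal.ofReal
        (24 * √m * (2 * √(∑ k, (∑ i, A i i k) ^ 2) + 36 * m * norm123 A)) := by
  set μ := ProbabilityTheory.stdGaussian (EuclideanSpace ℝ ι)
  set T : EuclideanSpace ℝ ι → ℝ := fun x => ∑ i, ∑ j, ∑ k, A i j k * x i * x j * x k with hT
  set P : EuclideanSpace ℝ ι × EuclideanSpace ℝ ι → ℝ := fun z =>
    ∑ i, ∑ j, ∑ k, A i j k * z.1 i * z.1 j * z.2 k with hP
  have hTm : Measurable T := by fun_prop
  have hPm : Measurable P := by fun_prop
  set q : ℝ := 3 * √m * (2 * √(∑ k, (∑ i, A i i k) ^ 2) + 36 * m * norm123 A) with hq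
  have hq0 : 0 ≤ q := by
    have : 0 ≤ norm123 A := Real.sqrt_nonneg _
    positivity
  have hPq : eLpNorm P (2 * m : ℕ) (μ.prod μ) ≤ ENNReal.ofReal q :=
    eLpNorm_quadratic_linear_stdGaussian_le hm hA
  have hPq' : eLpNorm (P ∘ Prod.swap) (2 * m : ℕ) (μ.prod μ) ≤ ENNReal.ofReal q := by
    rwa [eLpNorm_comp_measurePreserving hPm.aestronglyMeasurable Measure.measurePreserving_swap]
  have hp1 : (1 : ℝ≥0∞) ≤ (2 * m : ℕ) := by
    exact_mod_cast Nat.one_le_iff_ne_zero.2 (by positivity)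
  have hexp (z : EuclideanSpace ℝ ι × EuclideanSpace ℝ ι) :
      T ((√2)⁻¹ • (z.1 + z.2))
        = (√2)⁻¹ ^ 3 * (T z.1 + T z.2 + 3 * (P z + P z.swap)) := by
    have hlast (x y : EuclideanSpace ℝ ι) :
        ∑ i, ∑ j, ∑ k, A i j k * x i * y j * x k = P (x, y) := by
      refine Finset.sum_congr rfl fun i _ => ?_
      rw [Finset.sum_comm]
      refine Finset.sum_congr rfl fun j _ => Finset.sum_congr rfl fun k _ => ?_
      rw [hA' i k j]
      ring
    have hfirst (x y : EuclideanSpace ℝ ι) :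
        ∑ i, ∑ j, ∑ k, A i j k * y i * x j * x k = P (x, y) := by
      rw [← hlast, Finset.sum_comm]
      refine Finset.sum_congr rfl fun i _ => Finset.sum_congr rfl fun j _ =>
        Finset.sum_congr rfl fun k _ => ?_
      rw [hA j i k]
      ring
    have hterm (i j k : ι) :
        A i j k * ((√2)⁻¹ * (z.1 i + z.2 i)) * ((√2)⁻¹ * (z.1 j + z.2 j))
            * ((√2)⁻¹ * (z.1 k + z.2 k))
          = (√2)⁻¹ ^ 3 * (A i j k * z.1 i * z.1 j * z.1 k + A i j k * z.2 i * z.2 j * z.2 k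
            + (A i j k * z.1 i * z.1 j * z.2 k + A i j k * z.1 i * z.2 j * z.1 k
              + A i j k * z.2 i * z.1 j * z.1 k)
            + (A i j k * z.2 i * z.2 j * z.1 k + A i j k * z.2 i * z.1 j * z.2 k
              + A i j k * z.1 i * z.2 j * z.2 k)) := by
      ring
    simp only [hT, PiLp.smul_apply, PiLp.add_apply, smul_eq_mul, hterm, ← Finset.mul_sum,
      Finset.sum_add_distrib]
    simp only [hlast, hfirst, hP, Prod.fst_swap, Prod.snd_swap]
    ring
  obtain ⟨n, hn0, hn⟩ : ∃ n : ℝ, 0 ≤ n ∧ eLpNorm T (2 * m : ℕ) μ = ENNReal.ofReal n :=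
    ⟨_, ENNReal.toReal_nonneg, (ENNReal.ofReal_toReal
      (memLp_cubic_stdGaussian A (ENNReal.natCast_ne_top _)).eLpNorm_ne_top).symm⟩
  have hfst : eLpNorm (fun z : EuclideanSpace ℝ ι × EuclideanSpace ℝ ι => T z.1) (2 * m : ℕ)
      (μ.prod μ) = ENNReal.ofReal n :=
    (eLpNorm_comp_measurePreserving hTm.aestronglyMeasurable measurePreserving_fst).trans hn
  have hsnd : eLpNorm (fun z : EuclideanSpace ℝ ι × EuclideanSpace ℝ ι => T z.2) (2 * m : ℕ)
      (μ.prod μ) = ENNReal.ofReal n :=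
    (eLpNorm_comp_measurePreserving hTm.aestronglyMeasurable measurePreserving_snd).trans hn
  have hrec : ENNReal.ofReal n
      ≤ ENNReal.ofReal ((√2)⁻¹ ^ 3 * (n + n + 3 * (q + q))) := by
    calc ENNReal.ofReal n
        = eLpNorm ((√2)⁻¹ ^ 3 • ((fun z : EuclideanSpace ℝ ι × EuclideanSpace ℝ ι => T z.1)
            + (fun z => T z.2) + (3 : ℝ) • (P + P ∘ Prod.swap))) (2 * m : ℕ) (μ.prod μ) := by
          rw [← hfst, ← eLpNorm_comp_measurePreserving (by fun_prop)
            (measurePreserving_rotation_stdGaussian ι)]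
          congr 1
          ext z
          exact hexp z
      _ ≤ ENNReal.ofReal ((√2)⁻¹ ^ 3) * (ENNReal.ofReal n + ENNReal.ofReal n
            + ENNReal.ofReal 3 * (ENNReal.ofReal q + ENNReal.ofReal q)) := by
          rw [eLpNorm_const_smul, Real.enorm_of_nonneg (by positivity)]
          gcongr
          refine (eLpNorm_add_le (by fun_prop) (by fun_prop) hp1).trans ?_
          gcongr
          · refine (eLpNorm_add_le (by fun_prop) (by fun_prop) hp1).trans ?_
            rw [hfst, hsnd]
          · rw [eLpNorm_const_smul, Real.enorm_of_nonneg (by positivity)]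
            gcongr
            exact (eLpNorm_add_le (by fun_prop) (by fun_prop) hp1).trans
              (add_le_add hPq hPq')
      _ = _ := by
          rw [← ENNReal.ofReal_add hq0 hq0, ← ENNReal.ofReal_add hn0 hn0,
            ← ENNReal.ofReal_mul zero_le_three, ← ENNReal.ofReal_add (add_nonneg hn0 hn0)
              (mul_nonneg zero_le_three (add_nonneg hq0 hq0)),
            ← ENNReal.ofReal_mul (by positivity)]
  rw [ENNReal.ofReal_le_ofReal_iff (by positivity)] at hrec
  have hs : (√2)⁻¹ ^ 3 ≤ 0.36 := by
    have h1 : (1.41 : ℝ) ≤ √2 := Real.le_sqrt_of_sq_le (by norm_num)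
    calc (√2)⁻¹ ^ 3 ≤ (1.41)⁻¹ ^ 3 := by gcongr
      _ ≤ 0.36 := by norm_num
  have hle : n ≤ 8 * q := by
    have := mul_le_mul_of_nonneg_right hs (show 0 ≤ n + n + 3 * (q + q) by positivity)
    linarith
  rw [hn]
  refine ENNReal.ofReal_le_ofReal (hle.trans (le_of_eq ?_))
  rw [hq]
  ring

lemma sqrt_sum_partialTrace_sq_le {ι : Type*} [Fintype ι] [DecidableEq ι] (A : ι → ι → ι → ℝ) :
    √(∑ k, (∑ i, A i i k) ^ 2) ≤ √(Fintype.card ι) * norm12_3 A := by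
  have hbdd : BddAbove { s | ∃ (X : ι → ι → ℝ) (y : ι → ℝ), (∑ i, ∑ j, (X i j)^2) ≤ 1 ∧
      (∑ k, (y k)^2) ≤ 1 ∧ s = ∑ i, ∑ j, ∑ k, A i j k * X i j * y k } := by
    refine ⟨∑ i, ∑ j, ∑ k, |A i j k|, ?_⟩
    rintro s ⟨X, y, hX, hy, rfl⟩
    refine Finset.sum_le_sum fun i _ => Finset.sum_le_sum fun j _ =>
      Finset.sum_le_sum fun k _ => ?_
    have hXij : |X i j| ≤ 1 := by
      rw [← sq_le_one_iff_abs_le_one]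
      refine le_trans ?_ hX
      exact (Finset.single_le_sum (f := fun j => X i j ^ 2) (fun _ _ => sq_nonneg _)
        (Finset.mem_univ j)).trans (Finset.single_le_sum (f := fun i => ∑ j, X i j ^ 2)
          (fun _ _ => by positivity) (Finset.mem_univ i))
    have hyk : |y k| ≤ 1 := by
      rw [← sq_le_one_iff_abs_le_one]
      exact (Finset.single_le_sum (f := fun k => y k ^ 2) (fun _ _ => sq_nonneg _)
        (Finset.mem_univ k)).trans hy
    refine (le_abs_self _).trans ?_
    rw [abs_mul, abs_mul, mul_assoc]
    exact mul_le_of_le_one_right (abs_nonneg _) (mul_le_one₀ hXij (abs_nonneg _) hyk)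
  set b : ℝ := √(∑ k, (∑ i, A i i k) ^ 2) with hb
  have hb2 : b ^ 2 = ∑ k, (∑ i, A i i k) ^ 2 := Real.sq_sqrt (by positivity)
  have hD : √(Fintype.card ι) ^ 2 = Fintype.card ι := Real.sq_sqrt (by positivity)
  set D : ℝ := √(Fintype.card ι)
  have hmem : D⁻¹ * b ≤ norm12_3 A := by
    refine le_csSup hbdd ⟨fun i j => if i = j then D⁻¹ else 0, fun k => b⁻¹ * ∑ i, A i i k,
      ?_, ?_, ?_⟩
    · simp only [ite_pow, zero_pow two_ne_zero, Finset.sum_ite_eq, Finset.mem_univ, if_true,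
        Finset.sum_const, Finset.card_univ, nsmul_eq_mul]
      rw [← hD, inv_pow]
      exact mul_inv_le_one
    · simp only [mul_pow]
      rw [← Finset.mul_sum, ← hb2, inv_pow]
      exact inv_mul_le_one
    · have hik (i j k : ι) : A i j k * (if i = j then D⁻¹ else 0) * (b⁻¹ * ∑ i, A i i k)
          = if i = j then D⁻¹ * b⁻¹ * (A i j k * ∑ i, A i i k) else 0 := by
        split_ifs <;> ring
      simp only [hik]
      have hi (i : ι) : ∑ j, ∑ k, (if i = j then D⁻¹ * b⁻¹ * (A i j k * ∑ i, A i i k) else 0)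
          = D⁻¹ * b⁻¹ * ∑ k, A i i k * ∑ i, A i i k := by
        rw [Finset.sum_comm]
        simp [Finset.mul_sum]
      simp only [hi, ← Finset.mul_sum]
      rw [Finset.sum_comm]
      simp only [← Finset.sum_mul, ← sq]
      rw [← hb2]
      by_cases h0 : b = 0
      · simp [h0]
      · field_simp
  rcases isEmpty_or_nonempty ι with hι | hι
  · simp [hb, D]
  · have hD0 : 0 < D := Real.sqrt_pos.2 (by exact_mod_cast Fintype.card_pos)
    rwa [inv_mul_le_iff₀ hD0] at hmem

/-! ### Symmetry of the third derivative -/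

lemma iteratedFDeriv_three_apply_swap_left {E : Type*} [NormedAddCommGroup E] [NormedSpace ℝ E]
    {f : E → ℝ} (hf : ContDiff ℝ 3 f) (x u v w : E) :
    iteratedFDeriv ℝ 3 f x ![u, v, w] = iteratedFDeriv ℝ 3 f x ![v, u, w] := by
  have hf' : ContDiff ℝ 2 (fderiv ℝ f) := hf.fderiv_right (by norm_num)
  have hsymm := hf'.contDiffAt (x := x) |>.isSymmSndFDerivAt (by simp)
  have h (u v w : E) : iteratedFDeriv ℝ 3 f x ![u, v, w]
      = fderiv ℝ (fderiv ℝ (fderiv ℝ f)) x u v w := by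
    rw [iteratedFDeriv_succ_apply_right, iteratedFDeriv_two_apply]
    rfl
  rw [h, h, hsymm.eq u v]

lemma iteratedFDeriv_three_apply_swap_right {E : Type*} [NormedAddCommGroup E] [NormedSpace ℝ E]
    {f : E → ℝ} (hf : ContDiff ℝ 3 f) (x u v w : E) :
    iteratedFDeriv ℝ 3 f x ![u, v, w] = iteratedFDeriv ℝ 3 f x ![u, w, v] := by
  have hdiff : Differentiable ℝ (iteratedFDeriv ℝ 2 f) :=
    hf.differentiable_iteratedFDeriv (by norm_num)
  have h (v w : E) : iteratedFDeriv ℝ 3 f x ![u, v, w]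
      = fderiv ℝ (fun y => iteratedFDeriv ℝ 2 f y ![v, w]) x u := by
    rw [fderiv_continuousMultilinear_apply_const_apply (hdiff x), iteratedFDeriv_succ_apply_left]
    rfl
  rw [h, h]
  congr 2
  ext y
  rw [iteratedFDeriv_two_apply, iteratedFDeriv_two_apply]
  exact (hf.contDiffAt.isSymmSndFDerivAt (by norm_num)).eq v w

/-- **Lemma (Gaussian moment bound for the cubic form of the third derivative).** -/
theorem third_derivative_cubic_form_moment_bound :
    ∃ c : ℝ, 0 < c ∧
    ∀ (d : ℕ) (ℓ : ℕ) (f : Euc d → ℝ) (x : Euc d),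
      1 ≤ ℓ → ContDiff ℝ 3 f →
      (∫⁻ p : Euc d,
          ENNReal.ofReal
            (|∑ i, ∑ j, ∑ k, tensor3 f x i j k * p i * p j * p k| ^ ℓ)
          ∂(stdGaussian d)) ^ ((ℓ : ℝ)⁻¹)
        ≤ ENNReal.ofReal (c * ((ℓ : ℝ) ^ ((3:ℝ)/2) * norm123 (tensor3 f x)
            + (ℓ : ℝ) ^ ((1:ℝ)/2) * (d : ℝ) ^ ((1:ℝ)/2) * norm12_3 (tensor3 f x))) := by
  refine ⟨864, by norm_num, fun d ℓ f x hℓ hf => ?_⟩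
  have hℓ0 : ℓ ≠ 0 := Nat.one_le_iff_ne_zero.1 hℓ
  have hμ : stdGaussian d = ProbabilityTheory.stdGaussian (EuclideanSpace ℝ (Fin d)) :=
    ProbabilityTheory.map_pi_eq_stdGaussian
  have hA (i j k : Fin d) : tensor3 f x i j k = tensor3 f x j i k :=
    iteratedFDeriv_three_apply_swap_left hf x _ _ _
  have hA' (i j k : Fin d) : tensor3 f x i j k = tensor3 f x i k j :=
    iteratedFDeriv_three_apply_swap_right hf x _ _ _
  generalize tensor3 f x = A at hA hA' ⊢
  set T : Euc d → ℝ := fun p => ∑ i, ∑ j, ∑ k, A i j k * p i * p j * p k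
  have hTm : Measurable T := by fun_prop
  have hlhs : (∫⁻ p, ENNReal.ofReal (|T p| ^ ℓ) ∂(stdGaussian d)) ^ ((ℓ : ℝ)⁻¹)
      = eLpNorm T ℓ (ProbabilityTheory.stdGaussian (EuclideanSpace ℝ (Fin d))) := by
    rw [hμ, ← ENNReal.pow_rpow_inv_natCast hℓ0 (eLpNorm T ℓ _), eLpNorm_natCast_pow _ _ hℓ0]
    simp_rw [Real.enorm_eq_ofReal_abs, ENNReal.ofReal_pow (abs_nonneg _)]
  rw [hlhs]
  have hexp : (ℓ : ℝ≥0∞) ≤ (2 * ℓ : ℕ) := by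
    exact_mod_cast Nat.le_mul_of_pos_left ℓ two_pos
  refine (eLpNorm_le_eLpNorm_of_exponent_le hexp hTm.aestronglyMeasurable).trans
    ((eLpNorm_cubic_stdGaussian_le hℓ0 hA hA').trans
    (ENNReal.ofReal_le_ofReal ?_))
  have htr := sqrt_sum_partialTrace_sq_le A
  rw [Fintype.card_fin] at htr
  have hpow : (ℓ : ℝ) ^ ((3 : ℝ) / 2) = ℓ * √ℓ := by
    rw [show (3 : ℝ) / 2 = 1 + 1 / 2 by norm_num, Real.rpow_add (by positivity), Real.rpow_one,
      Real.sqrt_eq_rpow]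
  rw [hpow, ← Real.sqrt_eq_rpow, ← Real.sqrt_eq_rpow]
  have h1 := mul_le_mul_of_nonneg_left htr (Real.sqrt_nonneg ℓ)
  have h2 : 0 ≤ √ℓ * √(∑ k, (∑ i, A i i k) ^ 2) := by positivity
  linarith
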